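/- Let a_{kl} = ∫_{ℝ²} 1_{{x ≤ y}} H_k(x) H_l(y) φ(x) φ(y) dx dy for k, l ≥ 0. Then the double series ∑_{k,l ≥ 1} |a_{kl}| / √(k! l!) diverges (equals +∞); in particular the family (|a_{kl}|/√(k! l!))_{k,l ≥ 1} is not summable. -/

import Mathlib

open MeasureTheory Real

/-- Probabilist's Hermite polynomial `H_k(x)`. -/
noncomputable def hermiteFun (k : ℕ) (x : ℝ) : ℝ := Polynomial.aeval x (Polynomial.hermite k)

/-- Standard normal density `φ(x) = (2π)^{-1/2} e^{-x²/2}`. -/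
noncomputable def stdNormalDensity (x : ℝ) : ℝ :=
  (Real.sqrt (2 * Real.pi))⁻¹ * Real.exp (-x ^ 2 / 2)

/-- Hermite coefficients of the Wilcoxon kernel `h(x,y) = 1_{x ≤ y}`. -/
noncomputable def wilcoxonCoeff (k l : ℕ) : ℝ :=
  ∫ q : ℝ × ℝ, (if q.1 ≤ q.2 then (1 : ℝ) else 0) * hermiteFun k q.1 * hermiteFun l q.2 *
    stdNormalDensity q.1 * stdNormalDensity q.2

open Polynomial in
theorem Polynomial.derivative_hermite_succ (n : ℕ) :
    derivative (hermite (n + 1)) = (n + 1 : ℤ[X]) * hermite n := by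
  induction n with
  | zero => simp
  | succ n ih =>
    rw [hermite_succ (n + 1)]
    simp only [derivative_sub, derivative_mul, derivative_X, ih, derivative_add,
      derivative_natCast, derivative_one]
    rw [hermite_succ n]
    push_cast
    ring

theorem integrable_aeval_mul_exp_neg_mul_sq {b : ℝ} (hb : 0 < b) (p : Polynomial ℤ) :
    Integrable fun x : ℝ => Polynomial.aeval x p * exp (-b * x ^ 2) := by
  induction p using Polynomial.induction_on' with
  | add p q hp hq =>
    simp only [map_add, add_mul]
    exact hp.add hq
  | monomial n a =>
    have h := integrable_rpow_mul_exp_neg_mul_sq hb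
      (lt_of_lt_of_le (by norm_num) (Nat.cast_nonneg n) : (-1 : ℝ) < n)
    simp only [rpow_natCast] at h
    simpa [Polynomial.aeval_monomial, mul_assoc] using h.const_mul (a : ℝ)

theorem hasDerivAt_aeval_mul_exp_neg_mul_sq (b : ℝ) (p : Polynomial ℤ) (x : ℝ) :
    HasDerivAt (fun x : ℝ => Polynomial.aeval x p * exp (-b * x ^ 2))
      ((Polynomial.aeval x (Polynomial.derivative p) - 2 * b * x * Polynomial.aeval x p) *
        exp (-b * x ^ 2)) x := by
  have h := (p.hasDerivAt_aeval x).mul (((hasDerivAt_pow 2 x).const_mul (-b)).exp)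
  refine h.congr_deriv ?_
  push_cast
  ring

/-- The linear functional `p ↦ ∫ p(x) e^{-x²} dx`. -/
noncomputable def gaussSqIntegral (p : Polynomial ℤ) : ℝ :=
  ∫ x : ℝ, Polynomial.aeval x p * exp (-1 * x ^ 2)

theorem gaussSqIntegral_add (p q : Polynomial ℤ) :
    gaussSqIntegral (p + q) = gaussSqIntegral p + gaussSqIntegral q := by
  simp only [gaussSqIntegral, map_add, add_mul]
  exact integral_add (integrable_aeval_mul_exp_neg_mul_sq one_pos p)
    (integrable_aeval_mul_exp_neg_mul_sq one_pos q)

theorem gaussSqIntegral_intCast_mul (a : ℤ) (p : Polynomial ℤ) :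
    gaussSqIntegral (a * p) = a * gaussSqIntegral p := by
  simp only [gaussSqIntegral, map_mul, map_intCast, mul_assoc]
  exact integral_const_mul _ _

/-- Integration by parts against `e^{-x²}`. -/
theorem gaussSqIntegral_derivative_sub (p : Polynomial ℤ) :
    gaussSqIntegral (Polynomial.derivative p - 2 * Polynomial.X * p) = 0 := by
  refine integral_eq_zero_of_hasDerivAt_of_integrable
    (f := fun x : ℝ => Polynomial.aeval x p * exp (-1 * x ^ 2)) (fun x => ?_)
    (integrable_aeval_mul_exp_neg_mul_sq one_pos _)
    (integrable_aeval_mul_exp_neg_mul_sq one_pos p)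
  refine (hasDerivAt_aeval_mul_exp_neg_mul_sq 1 p x).congr_deriv ?_
  simp only [map_sub, map_mul, map_ofNat, Polynomial.aeval_X, mul_one]

theorem gaussSqIntegral_hermite_succ_mul (m l : ℕ) :
    gaussSqIntegral (Polynomial.hermite (m + 1) * Polynomial.hermite l) =
      -gaussSqIntegral (Polynomial.hermite m * Polynomial.hermite (l + 1)) := by
  have h := gaussSqIntegral_derivative_sub (Polynomial.hermite m * Polynomial.hermite l)
  have e : Polynomial.derivative (Polynomial.hermite m * Polynomial.hermite l) -
      2 * Polynomial.X * (Polynomial.hermite m * Polynomial.hermite l) =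
      ((-1 : ℤ) : Polynomial ℤ) * (Polynomial.hermite (m + 1) * Polynomial.hermite l +
        Polynomial.hermite m * Polynomial.hermite (l + 1)) := by
    rw [Polynomial.hermite_succ, Polynomial.hermite_succ, Polynomial.derivative_mul]
    push_cast
    ring
  rw [e, gaussSqIntegral_intCast_mul, gaussSqIntegral_add] at h
  push_cast at h
  linarith

theorem abs_gaussSqIntegral_hermite_mul (m l : ℕ) :
    |gaussSqIntegral (Polynomial.hermite m * Polynomial.hermite l)| =
      |gaussSqIntegral (Polynomial.hermite (m + l))| := by
  induction m generalizing l with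
  | zero => simp
  | succ m ih =>
    rw [gaussSqIntegral_hermite_succ_mul, abs_neg, ih]
    congr 3
    ring

theorem gaussSqIntegral_hermite_add_two (n : ℕ) :
    gaussSqIntegral (Polynomial.hermite (n + 2)) =
      -((n + 1) / 2) * gaussSqIntegral (Polynomial.hermite n) := by
  have h := gaussSqIntegral_derivative_sub (Polynomial.hermite (n + 1))
  have e : Polynomial.derivative (Polynomial.hermite (n + 1)) -
      2 * Polynomial.X * Polynomial.hermite (n + 1) =
      ((-2 : ℤ) : Polynomial ℤ) * Polynomial.hermite (n + 2) +
        ((-(n + 1) : ℤ) : Polynomial ℤ) * Polynomial.hermite n := by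
    rw [Polynomial.hermite_succ (n + 1), Polynomial.derivative_hermite_succ]
    push_cast
    ring
  rw [e, gaussSqIntegral_add, gaussSqIntegral_intCast_mul, gaussSqIntegral_intCast_mul] at h
  push_cast at h
  linarith

theorem gaussSqIntegral_hermite_zero : gaussSqIntegral (Polynomial.hermite 0) = √π := by
  simpa [gaussSqIntegral] using integral_gaussian 1

theorem pi_div_four_le_gaussSqIntegral_hermite_sq (n : ℕ) :
    π / 4 * ((n + 1).factorial : ℝ) ^ 2 ≤
      (n + 1) * gaussSqIntegral (Polynomial.hermite (2 * (n + 1))) ^ 2 := by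
  induction n with
  | zero =>
    have h := gaussSqIntegral_hermite_add_two 0
    rw [gaussSqIntegral_hermite_zero] at h
    norm_num at h ⊢
    rw [h, neg_sq, mul_pow, sq_sqrt pi_pos.le]
    linarith
  | succ n ih =>
    rw [show 2 * (n + 1 + 1) = 2 * (n + 1) + 2 by ring, gaussSqIntegral_hermite_add_two,
      Nat.factorial_succ (n + 1)]
    push_cast
    set c := gaussSqIntegral (Polynomial.hermite (2 * (n + 1)))
    calc π / 4 * (((n : ℝ) + 1 + 1) * ((n + 1).factorial : ℝ)) ^ 2
        = ((n : ℝ) + 2) ^ 2 * (π / 4 * ((n + 1).factorial : ℝ) ^ 2) := by ring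
      _ ≤ ((n : ℝ) + 2) ^ 2 * ((n + 1) * c ^ 2) := by gcongr
      _ ≤ _ := by
        have : 0 ≤ ((n : ℝ) + 2) * c ^ 2 := by positivity
        nlinarith

theorem hermiteFun_mul_stdNormalDensity (k : ℕ) (x : ℝ) :
    hermiteFun k x * stdNormalDensity x =
      (√(2 * π))⁻¹ * (Polynomial.aeval x (Polynomial.hermite k) * exp (-(1 / 2) * x ^ 2)) := by
  rw [hermiteFun, stdNormalDensity, show -x ^ 2 / 2 = -(1 / 2) * x ^ 2 by ring]
  ring

theorem integrable_hermiteFun_mul_stdNormalDensity (k : ℕ) :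
    Integrable fun x => hermiteFun k x * stdNormalDensity x := by
  simp only [hermiteFun_mul_stdNormalDensity]
  exact (integrable_aeval_mul_exp_neg_mul_sq (by norm_num) _).const_mul _

theorem hasDerivAt_hermiteFun_mul_stdNormalDensity (k : ℕ) (x : ℝ) :
    HasDerivAt (fun x => hermiteFun k x * stdNormalDensity x)
      (-(hermiteFun (k + 1) x * stdNormalDensity x)) x := by
  simp only [hermiteFun_mul_stdNormalDensity]
  refine ((hasDerivAt_aeval_mul_exp_neg_mul_sq (1 / 2) (Polynomial.hermite k) x).const_mul
    (√(2 * π))⁻¹).congr_deriv ?_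
  rw [Polynomial.hermite_succ]
  simp only [map_sub, map_mul, Polynomial.aeval_X]
  ring

theorem setIntegral_Iic_hermiteFun_succ_mul_stdNormalDensity (k : ℕ) (y : ℝ) :
    ∫ x in Set.Iic y, hermiteFun (k + 1) x * stdNormalDensity x =
      -(hermiteFun k y * stdNormalDensity y) := by
  have hd := hasDerivAt_hermiteFun_mul_stdNormalDensity k
  have hi := (integrable_hermiteFun_mul_stdNormalDensity (k + 1)).neg
  have h := integral_Iic_of_hasDerivAt_of_tendsto' (a := y) (fun x _ => hd x) hi.integrableOn
    (tendsto_zero_of_hasDerivAt_of_integrableOn_Iic (a := y) (fun x _ => hd x) hi.integrableOn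
      (integrable_hermiteFun_mul_stdNormalDensity k).integrableOn)
  rw [integral_neg] at h
  linarith

theorem wilcoxonCoeff_succ (k l : ℕ) :
    wilcoxonCoeff (k + 1) l =
      -(2 * π)⁻¹ * gaussSqIntegral (Polynomial.hermite k * Polynomial.hermite l) := by
  let g (k : ℕ) (x : ℝ) := hermiteFun k x * stdNormalDensity x
  have hs : MeasurableSet {q : ℝ × ℝ | q.1 ≤ q.2} := measurableSet_le measurable_fst measurable_snd
  have e : wilcoxonCoeff (k + 1) l = ∫ q : ℝ × ℝ,
      Set.indicator {q : ℝ × ℝ | q.1 ≤ q.2} (fun q => g (k + 1) q.1 * g l q.2) q := by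
    refine integral_congr_ae (.of_forall fun q => ?_)
    by_cases h : q.1 ≤ q.2 <;> simp [g, h]
    ring
  have hi : Integrable (Set.indicator {q : ℝ × ℝ | q.1 ≤ q.2} fun q => g (k + 1) q.1 * g l q.2)
      (volume.prod volume) :=
    ((integrable_hermiteFun_mul_stdNormalDensity (k + 1)).mul_prod
      (integrable_hermiteFun_mul_stdNormalDensity l)).indicator hs
  rw [e, Measure.volume_eq_prod, integral_prod_symm _ hi, gaussSqIntegral, ← integral_const_mul]
  refine integral_congr_ae (.of_forall fun y => ?_)
  have hy : (fun x => Set.indicator {q : ℝ × ℝ | q.1 ≤ q.2} (fun q => g (k + 1) q.1 * g l q.2)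
      (x, y)) = Set.indicator (Set.Iic y) fun x => g (k + 1) x * g l y := by
    ext x
    simp [Set.indicator]
  simp only [hy]
  rw [integral_indicator measurableSet_Iic, integral_mul_const,
    setIntegral_Iic_hermiteFun_succ_mul_stdNormalDensity]
  simp only [g, hermiteFun_mul_stdNormalDensity, map_mul]
  have h2 : exp (-1 * y ^ 2) = exp (-(1 / 2) * y ^ 2) * exp (-(1 / 2) * y ^ 2) := by
    rw [← exp_add]
    ring_nf
  have h3 : (2 * π)⁻¹ = (√(2 * π))⁻¹ * (√(2 * π))⁻¹ := by
    rw [← mul_inv, mul_self_sqrt (by positivity)]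
  rw [h2, h3]
  ring

theorem wilcoxonCoeff_div_sqrt_factorial_lower_bound (j : ℕ) :
    (2 * π)⁻¹ * (√(π / 4) * (1 / ((j + 2 : ℕ) : ℝ))) ≤
      |wilcoxonCoeff (j + 1) (j + 1 + 1)| /
        √((j + 1).factorial * (j + 1 + 1).factorial) := by
  rw [wilcoxonCoeff_succ, abs_mul, abs_neg, abs_of_pos (a := (2 * π)⁻¹) (by positivity),
    abs_gaussSqIntegral_hermite_mul, mul_div_assoc,
    show j + (j + 1 + 1) = 2 * (j + 1) by ring]
  gcongr
  have h := pi_div_four_le_gaussSqIntegral_hermite_sq j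
  set c := gaussSqIntegral (Polynomial.hermite (2 * (j + 1)))
  rw [← sqrt_sq_eq_abs, ← sqrt_div (sq_nonneg c), Nat.factorial_succ (j + 1)]
  refine le_sqrt_of_sq_le ?_
  rw [mul_pow, sq_sqrt (by positivity), div_pow, one_pow, mul_one_div,
    div_le_div_iff₀ (by positivity) (by positivity)]
  push_cast
  calc π / 4 * (((j + 1).factorial : ℝ) * (((j : ℝ) + 1 + 1) * (j + 1).factorial))
      = (j + 2) * (π / 4 * ((j + 1).factorial : ℝ) ^ 2) := by ring
    _ ≤ (j + 2) * ((j + 1) * c ^ 2) := by gcongr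
    _ ≤ _ := by
      have : 0 ≤ ((j : ℝ) + 2) * c ^ 2 := by positivity
      nlinarith

theorem not_summable_wilcoxonCoeff_div_sqrt_factorial :
    ¬ Summable (fun kl : ℕ × ℕ =>
        |wilcoxonCoeff (kl.1 + 1) (kl.2 + 1)| /
          Real.sqrt ((kl.1 + 1).factorial * (kl.2 + 1).factorial)) := by
  intro h
  have hinj : Function.Injective fun j : ℕ => (j, j + 1) := fun a b hab => (Prod.ext_iff.1 hab).1
  have h1 := (h.comp_injective hinj).of_nonneg_of_le (fun j => by positivity)
    wilcoxonCoeff_div_sqrt_factorial_lower_bound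
  rw [summable_mul_left_iff (by positivity), summable_mul_left_iff (by positivity)] at h1
  exact not_summable_one_div_natCast
    ((summable_nat_add_iff (f := fun n : ℕ => 1 / (n : ℝ)) 2).1 h1)

/-- The double series `∑_{k,l ≥ 1} |a_{kl}|/√(k! l!)` diverges; in particular the family
is not summable. -/
theorem wilcoxonCoeff_sum_diverges :
    (∑' kl : ℕ × ℕ,
        ENNReal.ofReal (|wilcoxonCoeff (kl.1 + 1) (kl.2 + 1)| /
          Real.sqrt ((kl.1 + 1).factorial * (kl.2 + 1).factorial)) = ⊤) ∧
    ¬ Summable (fun kl : ℕ × ℕ =>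
        |wilcoxonCoeff (kl.1 + 1) (kl.2 + 1)| /
          Real.sqrt ((kl.1 + 1).factorial * (kl.2 + 1).factorial)) := by
  refine ⟨?_, not_summable_wilcoxonCoeff_div_sqrt_factorial⟩
  by_contra h
  refine not_summable_wilcoxonCoeff_div_sqrt_factorial ((ENNReal.summable_toReal h).congr ?_)
  exact fun kl => ENNReal.toReal_ofReal (by positivity)
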